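/- arXiv:2409.10487 — 3 statements merged into one kernel-verified Lean document; each statement's English description precedes it below -/
import Mathlib

section
/- For all complex matrices A : Matrix m n ℂ and B : Matrix p q ℂ (with m, n, p, q finite index types), the rank of the Kronecker product A ⊗ₖ B equals (rank A) · (rank B). -/
open Kronecker

/-- The rank of a tensor product of linear maps over a field is the product of the ranks. -/
theorem TensorProduct.finrank_range_map {K V V' W W' : Type*} [Field K]
    [AddCommGroup V] [Module K V] [AddCommGroup V'] [Module K V']
    [AddCommGroup W] [Module K W] [AddCommGroup W'] [Module K W']
    (f : V →ₗ[K] V') (g : W →ₗ[K] W') :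
    Module.finrank K (TensorProduct.map f g).range =
      Module.finrank K f.range * Module.finrank K g.range := by
  have hmap : TensorProduct.map f g = TensorProduct.mapIncl f.range g.range ∘ₗ
      TensorProduct.map f.rangeRestrict g.rangeRestrict := by
    ext x y
    rfl
  have hsurj : Function.Surjective (TensorProduct.map f.rangeRestrict g.rangeRestrict) :=
    TensorProduct.map_surjective f.surjective_rangeRestrict g.surjective_rangeRestrict
  have hinj : Function.Injective (TensorProduct.mapIncl f.range g.range) :=
    TensorProduct.map_injective_of_flat_flat _ _ f.range.injective_subtype
      g.range.injective_subtype
  rw [hmap, LinearMap.range_comp_of_range_eq_top _ (LinearMap.range_eq_top.2 hsurj),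
    LinearMap.finrank_range_of_inj hinj, Module.finrank_tensorProduct]

/-- The rank of a Kronecker product of matrices over a field is the product of the ranks. -/
theorem Matrix.rank_kronecker {K m n p q : Type*} [Field K] [Finite m] [Fintype n] [Finite p]
    [Fintype q] (A : Matrix m n K) (B : Matrix p q K) :
    (A ⊗ₖ B).rank = A.rank * B.rank := by
  classical
  cases nonempty_fintype m
  cases nonempty_fintype p
  rw [Matrix.rank_eq_finrank_range_toLin (A ⊗ₖ B)
      ((Pi.basisFun K m).tensorProduct (Pi.basisFun K p))
      ((Pi.basisFun K n).tensorProduct (Pi.basisFun K q)),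
    Matrix.toLin_kronecker, TensorProduct.finrank_range_map,
    ← Matrix.rank_eq_finrank_range_toLin A, ← Matrix.rank_eq_finrank_range_toLin B]

/-- The rank of a Kronecker product of complex matrices is the product of the ranks. -/
theorem rank_kronecker_eq_mul_rank
    (m n p q : Type*) [Fintype m] [Fintype n] [Fintype p] [Fintype q]
    [DecidableEq m] [DecidableEq n] [DecidableEq p] [DecidableEq q]
    (A : Matrix m n ℂ) (B : Matrix p q ℂ) :
    (A ⊗ₖ B).rank = A.rank * B.rank :=
  Matrix.rank_kronecker A B
end

section
/- Quantum teleportation correctness: let H = (1/√2) · !![1,1;1,-1], X = !![0,1;1,0], Z = !![1,0;0,-1], and CNOT = !![1,0,0,0; 0,1,0,0; 0,0,0,1; 0,0,1,0] (indexed by Fin 2 × Fin 2 in the ordering 00, 01, 10, 11). For any α, β : ℂ let φ = α e₀ + β e₁ ∈ ℂ². Then applying in order the gates 1 ⊗ₖ H ⊗ₖ 1, then 1 ⊗ₖ CNOT, then CNOT ⊗ₖ 1, then H ⊗ₖ 1 ⊗ₖ 1 to the three-qubit vector φ ⊗ₖ e₀ ⊗ₖ e₀ ∈ ℂ^{Fin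 2 × (Fin 2 × Fin 2)} yields (1/2) · [ (e₀ ⊗ₖ e₀) ⊗ₖ φ + (e₀ ⊗ₖ e₁) ⊗ₖ (X *ᵥ φ) + (e₁ ⊗ₖ e₀) ⊗ₖ (Z *ᵥ φ) + (e₁ ⊗ₖ e₁) ⊗ₖ (X *ᵥ (Z *ᵥ φ)) ] (reassociated to the index type Fin 2 × (Fin 2 × Fin 2)); hence after Alice measures her two qubits with outcome (a,b), Bob's qubit is Xᵇ Zᵃ φ and he recovers φ by applying the corresponding Pauli correction. -/
open Matrix Kronecker

/-- The index identification `(a, b) ↦ 2a + b` between `Fin 2 × Fin 2` and `Fin 4`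
(ordering `00, 01, 10, 11`). -/
def qidx (p : Fin 2 × Fin 2) : Fin 4 :=
  ⟨2 * p.1.val + p.2.val, by have := p.1.isLt; have := p.2.isLt; omega⟩

/-- The CNOT gate `!![1,0,0,0; 0,1,0,0; 0,0,0,1; 0,0,1,0]`, indexed by `Fin 2 × Fin 2`
in the ordering `00, 01, 10, 11`. -/
noncomputable def CNOT : Matrix (Fin 2 × Fin 2) (Fin 2 × Fin 2) ℂ :=
  Matrix.of fun p q =>
    (!![1,0,0,0; 0,1,0,0; 0,0,0,1; 0,0,1,0] : Matrix (Fin 4) (Fin 4) ℂ) (qidx p) (qidx q)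

/-- The Hadamard gate `H = (1/√2) !![1,1;1,-1]`. -/
noncomputable def H : Matrix (Fin 2) (Fin 2) ℂ :=
  ((Real.sqrt 2 : ℂ))⁻¹ • !![1,1;1,-1]

/-- The Pauli-X gate. -/
noncomputable def X : Matrix (Fin 2) (Fin 2) ℂ := !![0,1;1,0]

/-- The Pauli-Z gate. -/
noncomputable def Z : Matrix (Fin 2) (Fin 2) ℂ := !![1,0;0,-1]

/-- The standard basis vectors `e₀, e₁` of `ℂ²`. -/
noncomputable def e (i : Fin 2) : Fin 2 → ℂ := Pi.single i 1

/-- The Kronecker product `u ⊗ₖ v ⊗ₖ w` of three vectors of `ℂ²`, indexed by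
`Fin 2 × (Fin 2 × Fin 2)`. -/
def vec3 (u v w : Fin 2 → ℂ) : Fin 2 × (Fin 2 × Fin 2) → ℂ :=
  fun p => u p.1 * v p.2.1 * w p.2.2

/-- `CNOT ⊗ₖ 1`, reassociated to the index type `Fin 2 × (Fin 2 × Fin 2)`. -/
noncomputable def CNOT12 : Matrix (Fin 2 × (Fin 2 × Fin 2)) (Fin 2 × (Fin 2 × Fin 2)) ℂ :=
  Matrix.reindex (Equiv.prodAssoc (Fin 2) (Fin 2) (Fin 2))
    (Equiv.prodAssoc (Fin 2) (Fin 2) (Fin 2))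
    (CNOT ⊗ₖ (1 : Matrix (Fin 2) (Fin 2) ℂ))

theorem CNOT_apply (p q : Fin 2 × Fin 2) :
    CNOT p q = if (p.1, p.1 + p.2) = q then 1 else 0 := by
  obtain ⟨a, b⟩ := p
  obtain ⟨c, d⟩ := q
  fin_cases a <;> fin_cases b <;> fin_cases c <;> fin_cases d <;> simp [CNOT, qidx]

/-- Acting with a matrix on the left tensor factor. -/
theorem kronecker_one_mulVec {R m n : Type*} [CommSemiring R] [Fintype m] [Fintype n]
    [DecidableEq n] (A : Matrix m m R) (v : m × n → R) (p : m × n) :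
    ((A ⊗ₖ (1 : Matrix n n R)) *ᵥ v) p = (A *ᵥ fun i => v (i, p.2)) p.1 := by
  simp [mulVec, dotProduct, Fintype.sum_prod_type, one_apply]

/-- Acting with a matrix on the right tensor factor. -/
theorem one_kronecker_mulVec {R m n : Type*} [CommSemiring R] [Fintype m] [Fintype n]
    [DecidableEq m] (A : Matrix n n R) (v : m × n → R) (p : m × n) :
    (((1 : Matrix m m R) ⊗ₖ A) *ᵥ v) p = (A *ᵥ fun j => v (p.1, j)) p.2 := by
  simp [mulVec, dotProduct, Fintype.sum_prod_type_right, one_apply]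

theorem CNOT_mulVec (v : Fin 2 × Fin 2 → ℂ) (p : Fin 2 × Fin 2) :
    (CNOT *ᵥ v) p = v (p.1, p.1 + p.2) := by
  simp [mulVec, dotProduct, CNOT_apply]

theorem CNOT12_mulVec (v : Fin 2 × (Fin 2 × Fin 2) → ℂ) (p : Fin 2 × (Fin 2 × Fin 2)) :
    (CNOT12 *ᵥ v) p = v (p.1, p.1 + p.2.1, p.2.2) := by
  rw [CNOT12, reindex_apply, submatrix_mulVec_equiv, Function.comp_apply, kronecker_one_mulVec,
    CNOT_mulVec]
  rfl

theorem H_mulVec (v : Fin 2 → ℂ) :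
    H *ᵥ v = (Real.sqrt 2 : ℂ)⁻¹ • ![v 0 + v 1, v 0 - v 1] := by
  ext i
  fin_cases i <;> simp [H, mulVec, dotProduct, Fin.sum_univ_two] <;> ring

theorem X_mulVec (v : Fin 2 → ℂ) : X *ᵥ v = ![v 1, v 0] := by
  ext i
  fin_cases i <;> simp [X, mulVec, dotProduct, Fin.sum_univ_two]

theorem Z_mulVec (v : Fin 2 → ℂ) : Z *ᵥ v = ![v 0, -v 1] := by
  ext i
  fin_cases i <;> simp [Z, mulVec, dotProduct, Fin.sum_univ_two]

theorem inv_sqrt_two_mul_self : (Real.sqrt 2 : ℂ)⁻¹ * (Real.sqrt 2 : ℂ)⁻¹ = 1 / 2 := by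
  rw [← mul_inv, ← Complex.ofReal_mul, Real.mul_self_sqrt zero_le_two]
  norm_num

/-- **Quantum teleportation correctness.** Applying in order `1 ⊗ₖ H ⊗ₖ 1`, then
`1 ⊗ₖ CNOT`, then `CNOT ⊗ₖ 1`, then `H ⊗ₖ 1 ⊗ₖ 1` to `φ ⊗ₖ e₀ ⊗ₖ e₀` yields
`(1/2)[(e₀⊗e₀)⊗φ + (e₀⊗e₁)⊗(Xφ) + (e₁⊗e₀)⊗(Zφ) + (e₁⊗e₁)⊗(XZφ)]`; hence when Alice
measures outcome `(a, b)`, Bob's qubit is `Xᵇ Zᵃ φ` and the Pauli correction recovers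
`φ`. -/
theorem quantum_teleportation (α β : ℂ) :
    (H ⊗ₖ (1 : Matrix (Fin 2 × Fin 2) (Fin 2 × Fin 2) ℂ)) *ᵥ
      (CNOT12 *ᵥ
        (((1 : Matrix (Fin 2) (Fin 2) ℂ) ⊗ₖ CNOT) *ᵥ
          (((1 : Matrix (Fin 2) (Fin 2) ℂ) ⊗ₖ (H ⊗ₖ (1 : Matrix (Fin 2) (Fin 2) ℂ))) *ᵥ
            vec3 (α • e 0 + β • e 1) (e 0) (e 0)))) =
    (1 / 2 : ℂ) •
      (vec3 (e 0) (e 0) (α • e 0 + β • e 1)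
        + vec3 (e 0) (e 1) (X *ᵥ (α • e 0 + β • e 1))
        + vec3 (e 1) (e 0) (Z *ᵥ (α • e 0 + β • e 1))
        + vec3 (e 1) (e 1) (X *ᵥ (Z *ᵥ (α • e 0 + β • e 1)))) := by
  ext ⟨a, b, c⟩
  simp only [kronecker_one_mulVec, one_kronecker_mulVec, CNOT_mulVec, CNOT12_mulVec, H_mulVec,
    X_mulVec, Z_mulVec, Pi.smul_apply, Pi.add_apply, smul_eq_mul, vec3]
  rw [← inv_sqrt_two_mul_self]
  fin_cases a <;> fin_cases b <;> fin_cases c <;> simp [e] <;> ring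
end

section
/- Schmidt decomposition for 2 × 2 complex matrices (equivalently, two-qubit states): for every M : Matrix (Fin 2) (Fin 2) ℂ there exist unitary 2 × 2 matrices U and V and nonnegative real numbers β₀ ≥ β₁ ≥ 0 such that M = U * diagonal(β₀, β₁) * V; equivalently, writing the two-qubit state whose coordinate matrix is M, it equals Σ_{k=0}^{1} β_k (u_k ⊗ v_k) for orthonormal bases (u_k), (v_k) of ℂ², with Schmidt number ≤ 2. -/
namespace Matrix

open scoped ComplexOrder

variable {𝕜 n : Type*} [RCLike 𝕜] [Fintype n] [DecidableEq n]

/-- A matrix with pairwise orthogonal columns of norms `σ i` is a unitary times `diagonal σ`. -/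
theorem exists_eq_unitary_mul_diagonal (B : Matrix n n 𝕜) (σ : n → ℝ)
    (hB : Bᴴ * B = diagonal fun i => ((σ i : 𝕜)) ^ 2) :
    ∃ U ∈ unitaryGroup n 𝕜, B = U * diagonal fun i => (σ i : 𝕜) := by
  have hinner (i j : n) : ∑ k, star (B k i) * B k j = if i = j then (σ i : 𝕜) ^ 2 else 0 := by
    simpa [mul_apply, diagonal_apply] using congrFun₂ hB i j
  let v : n → EuclideanSpace 𝕜 n := fun i => WithLp.toLp 2 fun k => (σ i : 𝕜)⁻¹ * B k i
  have hv : Orthonormal 𝕜 ({i | σ i ≠ 0}.domRestrict v) := by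
    rw [orthonormal_iff_ite]
    rintro ⟨i, hi⟩ ⟨j, hj⟩
    have hi' : (σ i : 𝕜) ≠ 0 := by simpa using hi
    have key : inner 𝕜 (v i) (v j) =
        (σ i : 𝕜)⁻¹ * (σ j : 𝕜)⁻¹ * ∑ k, star (B k i) * B k j := by
      simp only [v, PiLp.inner_apply, RCLike.inner_apply, Finset.mul_sum, map_mul, map_inv₀, starRingEnd_apply]
      refine Finset.sum_congr rfl fun k _ => ?_
      simp
      ring
    simp only [Set.domRestrict_apply, key, hinner, Subtype.mk.injEq]
    split_ifs with h
    · subst h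
      field_simp
    · simp
  obtain ⟨b, hb⟩ := hv.exists_orthonormalBasis_extension_of_card_eq (by simp)
  refine ⟨of fun k i => b i k, ?_, ?_⟩
  · rw [mem_unitaryGroup_iff']
    ext i j
    have := orthonormal_iff_ite.mp b.orthonormal i j
    simpa [mul_apply, one_apply, PiLp.inner_apply, mul_comm] using this
  · ext k i
    rw [mul_diagonal, of_apply]
    by_cases hi : σ i = 0
    · have h := hinner i i
      have h' : ∑ k, ‖B k i‖ ^ 2 = 0 := by
        have : ((∑ k, ‖B k i‖ ^ 2 : ℝ) : 𝕜) = 0 := by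
          simpa [hi, RCLike.conj_mul] using h
        exact_mod_cast this
      have := (Finset.sum_eq_zero_iff_of_nonneg fun _ _ => by positivity).mp h' k (Finset.mem_univ k)
      simpa [hi] using this
    · have hi' : (σ i : 𝕜) ≠ 0 := by simpa using hi
      rw [hb i hi]
      simp only [v]
      field_simp

/-- Singular value decomposition of a square matrix. -/
theorem exists_eq_unitary_mul_diagonal_mul_unitary (M : Matrix n n 𝕜) :
    ∃ U ∈ unitaryGroup n 𝕜, ∃ V ∈ unitaryGroup n 𝕜, ∃ σ : n → ℝ,
      0 ≤ σ ∧ M = U * diagonal (fun i => (σ i : 𝕜)) * V := by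
  have hA : (Mᴴ * M).PosSemidef := posSemidef_conjTranspose_mul_self M
  obtain ⟨W, lam, hW, hlam, hspec⟩ : ∃ (W : Matrix n n 𝕜) (lam : n → ℝ), W ∈ unitaryGroup n 𝕜 ∧
      0 ≤ lam ∧ Mᴴ * M = W * diagonal (fun i => (lam i : 𝕜)) * Wᴴ :=
    ⟨_, _, hA.isHermitian.eigenvectorUnitary.2, hA.eigenvalues_nonneg,
      hA.isHermitian.spectral_theorem⟩
  have hWW : Wᴴ * W = 1 := mem_unitaryGroup_iff'.mp hW
  have hWW' : W * Wᴴ = 1 := mem_unitaryGroup_iff.mp hW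
  obtain ⟨U, hU, h⟩ := exists_eq_unitary_mul_diagonal (M * W) (fun i => √(lam i)) <| calc
      (M * W)ᴴ * (M * W) = Wᴴ * (Mᴴ * M) * W := by
        simp only [conjTranspose_mul, Matrix.mul_assoc]
      _ = (Wᴴ * W) * diagonal (fun i => (lam i : 𝕜)) * (Wᴴ * W) := by
        rw [hspec]; simp only [Matrix.mul_assoc]
      _ = diagonal fun i => ((√(lam i) : ℝ) : 𝕜) ^ 2 := by
        rw [hWW, Matrix.one_mul, Matrix.mul_one]
        congr 1
        ext i
        rw [← RCLike.ofReal_pow, Real.sq_sqrt (hlam i)]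
  refine ⟨U, hU, Wᴴ, Unitary.star_mem hW, fun i => √(lam i), fun i => Real.sqrt_nonneg _, ?_⟩
  rw [← h, Matrix.mul_assoc, hWW', Matrix.mul_one]

theorem submatrix_id_left_mem_unitaryGroup {U : Matrix n n 𝕜} (hU : U ∈ unitaryGroup n 𝕜)
    (e : Equiv.Perm n) : U.submatrix id e ∈ unitaryGroup n 𝕜 := by
  rw [mem_unitaryGroup_iff, star_eq_conjTranspose] at *
  rw [conjTranspose_submatrix, submatrix_mul_equiv, hU, submatrix_id_id]

theorem submatrix_id_right_mem_unitaryGroup {U : Matrix n n 𝕜} (hU : U ∈ unitaryGroup n 𝕜)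
    (e : Equiv.Perm n) : U.submatrix e id ∈ unitaryGroup n 𝕜 := by
  rw [mem_unitaryGroup_iff', star_eq_conjTranspose] at *
  rw [conjTranspose_submatrix, submatrix_mul_equiv, hU, submatrix_id_id]

/-- Singular value decomposition with the singular values in decreasing order. -/
theorem exists_antitone_eq_unitary_mul_diagonal_mul_unitary {m : ℕ}
    (M : Matrix (Fin m) (Fin m) 𝕜) :
    ∃ U ∈ unitaryGroup (Fin m) 𝕜, ∃ V ∈ unitaryGroup (Fin m) 𝕜, ∃ σ : Fin m → ℝ,
      0 ≤ σ ∧ Antitone σ ∧ M = U * diagonal (fun i => (σ i : 𝕜)) * V := by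
  obtain ⟨U, hU, V, hV, σ, hσ, h⟩ := exists_eq_unitary_mul_diagonal_mul_unitary M
  let e : Equiv.Perm (Fin m) := Tuple.sort (-σ)
  refine ⟨_, submatrix_id_left_mem_unitaryGroup hU e, _,
    submatrix_id_right_mem_unitaryGroup hV e, σ ∘ e, fun i => hσ (e i), fun i j hij => ?_, ?_⟩
  · simpa using Tuple.monotone_sort (-σ) hij
  · have hd : diagonal (fun i => ((σ ∘ e) i : 𝕜)) =
        (diagonal fun i => (σ i : 𝕜)).submatrix e e :=
      (submatrix_diagonal_equiv (fun i => (σ i : 𝕜)) e).symm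
    rw [hd, submatrix_mul_equiv, submatrix_mul_equiv, submatrix_id_id, ← h]

end Matrix


/-- **Schmidt decomposition for two-qubit states.** Every `2 × 2` complex matrix `M`
(the coordinate matrix of a two-qubit state) can be written as `M = U D V` with `U`, `V`
unitary and `D = diagonal (β₀, β₁)` for real numbers `β₀ ≥ β₁ ≥ 0`; equivalently the
state is `Σ_k β_k (u_k ⊗ v_k)` for orthonormal bases of `ℂ²`, with Schmidt number at
most `2`. -/
theorem schmidt_decomposition_two_qubits (M : Matrix (Fin 2) (Fin 2) ℂ) :
    ∃ (U V : Matrix (Fin 2) (Fin 2) ℂ) (β : Fin 2 → ℝ),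
      U ∈ Matrix.unitaryGroup (Fin 2) ℂ ∧ V ∈ Matrix.unitaryGroup (Fin 2) ℂ ∧
      β 1 ≤ β 0 ∧ 0 ≤ β 1 ∧
      M = U * Matrix.diagonal (fun i => (β i : ℂ)) * V := by
  obtain ⟨U, hU, V, hV, β, h0, hβ, h⟩ :=
    Matrix.exists_antitone_eq_unitary_mul_diagonal_mul_unitary M
  exact ⟨U, V, β, hU, hV, hβ (by decide), h0 1, h⟩
end
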